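/- arXiv:2507.06768 — 3 statements merged into one kernel-verified Lean document; each statement's English description precedes it below -/
import Mathlib

section
/- Let A and B be Hopf algebras over a field k with antipodes S_A, S_B, and let (P, i : A → P, j : B → P) be a coproduct of the underlying algebras in the category of associative unital k-algebras, equipped with the bialgebra structure (Δ_P, ε_P) characterized by Δ_P ∘ i = (i ⊗ i) ∘ Δ_A, Δ_P ∘ j = (j ⊗ j) ∘ Δ_B, ε_P ∘ i = ε_A, ε_P ∘ j = ε_B. Then there is a unique k-algebra anti-homomorphism S_P : P → P with S_P ∘ i = i ∘ S_A and S_P ∘ j = j ∘ S_B, and S_P is an antipode for the bialgebra P, i.e. m_P ∘ (S_P ⊗ id) ∘ Δ_P = u_P ∘ ε_P = m_P ∘ (id ⊗ S_P) ∘ Δ_P, so that P is a Hopf algebra and i, j are Hopf algebra homomorphisms. -/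
open TensorProduct

universe u

theorem cop_induction {k A B P : Type u} [Field k] [Ring A] [Ring B] [Ring P]
    [Algebra k A] [Algebra k B] [Algebra k P]
    (i : A →ₐ[k] P) (j : B →ₐ[k] P)
    (hP : ∀ (R : Type u) (_ : Ring R) (_ : Algebra k R) (φ : A →ₐ[k] R) (ψ : B →ₐ[k] R),
      ∃! χ : P →ₐ[k] R, χ.comp i = φ ∧ χ.comp j = ψ)
    (Q : Subalgebra k P) (hi : ∀ a, i a ∈ Q) (hj : ∀ b, j b ∈ Q) (p : P) : p ∈ Q := by
  obtain ⟨χ, ⟨h1, h2⟩, -⟩ := hP Q inferInstance inferInstance (i.codRestrict Q hi)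
    (j.codRestrict Q hj)
  have h : Q.val.comp χ = AlgHom.id k P := by
    refine (hP P inferInstance inferInstance i j).unique ⟨?_, ?_⟩ ⟨?_, ?_⟩
    · rw [AlgHom.comp_assoc, h1]; ext; rfl
    · rw [AlgHom.comp_assoc, h2]; ext; rfl
    · ext; rfl
    · ext; rfl
  have h' := DFunLike.congr_fun h p
  have h'' : ((χ p : Q) : P) = p := h'
  rw [← h'']
  exact (χ p).2

theorem left_conv_mul {k P : Type u} [Field k] [Ring P] [Algebra k P] (S : P →ₗ[k] P)
    (hS : ∀ x y : P, S (x * y) = S y * S x) (t u : P ⊗[k] P) (c d : k)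
    (ht : LinearMap.mul' k P (S.rTensor P t) = algebraMap k P c)
    (hu : LinearMap.mul' k P (S.rTensor P u) = algebraMap k P d) :
    LinearMap.mul' k P (S.rTensor P (t * u)) = algebraMap k P (c * d) := by
  have key : ∀ a b : P, LinearMap.mul' k P (S.rTensor P (t * (a ⊗ₜ b))) =
      S a * LinearMap.mul' k P (S.rTensor P t) * b := by
    intro a b
    clear ht
    induction t with
    | zero => simp
    | add x y hx hy => simp only [add_mul, map_add, hx, hy, mul_add]
    | tmul x y => simp [hS, mul_assoc]
  have key2 : LinearMap.mul' k P (S.rTensor P (t * u)) =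
      algebraMap k P c * LinearMap.mul' k P (S.rTensor P u) := by
    clear hu
    induction u with
    | zero => simp
    | add x y hx hy => simp only [mul_add, map_add, hx, hy]
    | tmul x y =>
      rw [key, ht, ← Algebra.commutes]
      simp [mul_assoc]
  rw [key2, hu, map_mul]

theorem right_conv_mul {k P : Type u} [Field k] [Ring P] [Algebra k P] (S : P →ₗ[k] P)
    (hS : ∀ x y : P, S (x * y) = S y * S x) (t u : P ⊗[k] P) (c d : k)
    (ht : LinearMap.mul' k P (S.lTensor P t) = algebraMap k P c)
    (hu : LinearMap.mul' k P (S.lTensor P u) = algebraMap k P d) :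
    LinearMap.mul' k P (S.lTensor P (t * u)) = algebraMap k P (c * d) := by
  have key : ∀ a b : P, LinearMap.mul' k P (S.lTensor P ((a ⊗ₜ b) * u)) =
      a * LinearMap.mul' k P (S.lTensor P u) * S b := by
    intro a b
    clear hu
    induction u with
    | zero => simp
    | add x y hx hy => simp only [add_mul, map_add, hx, hy, mul_add]
    | tmul x y => simp [hS, mul_assoc]
  have key2 : LinearMap.mul' k P (S.lTensor P (t * u)) =
      algebraMap k P d * LinearMap.mul' k P (S.lTensor P t) := by
    clear ht
    induction t with
    | zero => simp
    | add x y hx hy => simp only [mul_add, add_mul, map_add, hx, hy]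
    | tmul x y =>
      rw [key, hu, ← Algebra.commutes]
      simp [mul_assoc]
  rw [key2, ht, ← map_mul, mul_comm]

theorem left_conv_gen {k A P : Type u} [Field k] [Ring A] [Ring P] [HopfAlgebra k A]
    [Algebra k P] (i : A →ₐ[k] P) (S : P →ₗ[k] P)
    (h : S ∘ₗ i.toLinearMap = i.toLinearMap ∘ₗ HopfAlgebra.antipode (R := k)) (a : A) :
    LinearMap.mul' k P (S.rTensor P (Algebra.TensorProduct.map i i (Coalgebra.comul (R := k) a)))
      = algebraMap k P (Coalgebra.counit (R := k) a) := by
  have h' : ∀ x, S (i x) = i (HopfAlgebra.antipode k x) := fun x => LinearMap.congr_fun h x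
  have key : ∀ t : A ⊗[k] A, LinearMap.mul' k P (S.rTensor P (Algebra.TensorProduct.map i i t))
      = i (LinearMap.mul' k A ((HopfAlgebra.antipode k).rTensor A t)) := by
    intro t
    induction t with
    | zero => simp
    | add x y hx hy => simp only [map_add, hx, hy]
    | tmul x y => simp [h']
  rw [key, HopfAlgebra.mul_antipode_rTensor_comul_apply, AlgHom.commutes]

theorem right_conv_gen {k A P : Type u} [Field k] [Ring A] [Ring P] [HopfAlgebra k A]
    [Algebra k P] (i : A →ₐ[k] P) (S : P →ₗ[k] P)
    (h : S ∘ₗ i.toLinearMap = i.toLinearMap ∘ₗ HopfAlgebra.antipode (R := k)) (a : A) :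
    LinearMap.mul' k P (S.lTensor P (Algebra.TensorProduct.map i i (Coalgebra.comul (R := k) a)))
      = algebraMap k P (Coalgebra.counit (R := k) a) := by
  have h' : ∀ x, S (i x) = i (HopfAlgebra.antipode k x) := fun x => LinearMap.congr_fun h x
  have key : ∀ t : A ⊗[k] A, LinearMap.mul' k P (S.lTensor P (Algebra.TensorProduct.map i i t))
      = i (LinearMap.mul' k A ((HopfAlgebra.antipode k).lTensor A t)) := by
    intro t
    induction t with
    | zero => simp
    | add x y hx hy => simp only [map_add, hx, hy]
    | tmul x y => simp [h']
  rw [key, HopfAlgebra.mul_antipode_lTensor_comul_apply, AlgHom.commutes]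

/-- The antipode followed by an algebra map, as an algebra map to the opposite algebra. -/
noncomputable def opAntipode {k A P : Type u} [Field k] [Ring A] [Ring P] [HopfAlgebra k A]
    [Algebra k P] (i : A →ₐ[k] P) : A →ₐ[k] Pᵐᵒᵖ :=
  AlgHom.ofLinearMap
    ((MulOpposite.opLinearEquiv k).toLinearMap ∘ₗ i.toLinearMap ∘ₗ HopfAlgebra.antipode k)
    (by simp) (by intro x y; simp [HopfAlgebra.antipode_mul_antidistrib])


/-- Let `A`, `B` be Hopf algebras over `k`, `(P, i, j)` a coproduct of the underlying algebras
in the category of `k`-algebras, equipped with the bialgebra structure `(Δ_P, ε_P)`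
characterized by `Δ_P ∘ i = (i ⊗ i) ∘ Δ_A`, `Δ_P ∘ j = (j ⊗ j) ∘ Δ_B`, `ε_P ∘ i = ε_A`,
`ε_P ∘ j = ε_B`.  Then there is a unique `k`-algebra anti-homomorphism `S_P : P → P` with
`S_P ∘ i = i ∘ S_A` and `S_P ∘ j = j ∘ S_B`, and any such `S_P` is an antipode for `P`:
`m ∘ (S_P ⊗ id) ∘ Δ_P = u ∘ ε_P = m ∘ (id ⊗ S_P) ∘ Δ_P`.  Hence `P` is a Hopf algebra and
`i`, `j` are Hopf algebra homomorphisms. -/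
theorem coproduct_of_algebras_antipode
    (k : Type u) [Field k] (A B P : Type u) [Ring A] [Ring B] [Ring P]
    [HopfAlgebra k A] [HopfAlgebra k B] [Algebra k P]
    (i : A →ₐ[k] P) (j : B →ₐ[k] P)
    -- `(P, i, j)` is a coproduct of `A` and `B` in the category of `k`-algebras
    (hP : ∀ (R : Type u) (_ : Ring R) (_ : Algebra k R) (φ : A →ₐ[k] R) (ψ : B →ₐ[k] R),
      ∃! χ : P →ₐ[k] R, χ.comp i = φ ∧ χ.comp j = ψ)
    -- the induced bialgebra structure on `P`
    (ΔP : P →ₐ[k] P ⊗[k] P) (εP : P →ₐ[k] k)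
    (hΔi : ΔP.comp i = (Algebra.TensorProduct.map i i).comp (Bialgebra.comulAlgHom k A))
    (hΔj : ΔP.comp j = (Algebra.TensorProduct.map j j).comp (Bialgebra.comulAlgHom k B))
    (hεi : εP.comp i = Bialgebra.counitAlgHom k A)
    (hεj : εP.comp j = Bialgebra.counitAlgHom k B) :
    -- unique algebra anti-homomorphism compatible with the antipodes of `A` and `B`
    (∃! SP : P →ₗ[k] P,
      (SP 1 = 1 ∧ ∀ x y : P, SP (x * y) = SP y * SP x) ∧
      SP ∘ₗ i.toLinearMap = i.toLinearMap ∘ₗ HopfAlgebra.antipode (R := k) ∧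
      SP ∘ₗ j.toLinearMap = j.toLinearMap ∘ₗ HopfAlgebra.antipode (R := k)) ∧
    -- and any such anti-homomorphism is an antipode for the bialgebra `P`
    (∀ SP : P →ₗ[k] P,
      (SP 1 = 1 ∧ ∀ x y : P, SP (x * y) = SP y * SP x) →
      SP ∘ₗ i.toLinearMap = i.toLinearMap ∘ₗ HopfAlgebra.antipode (R := k) →
      SP ∘ₗ j.toLinearMap = j.toLinearMap ∘ₗ HopfAlgebra.antipode (R := k) →
      (LinearMap.mul' k P ∘ₗ (SP.rTensor P) ∘ₗ ΔP.toLinearMap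
          = Algebra.linearMap k P ∘ₗ εP.toLinearMap) ∧
      (LinearMap.mul' k P ∘ₗ (SP.lTensor P) ∘ₗ ΔP.toLinearMap
          = Algebra.linearMap k P ∘ₗ εP.toLinearMap)) := by
  have hΔi' : ∀ a, ΔP (i a) = Algebra.TensorProduct.map i i (Coalgebra.comul (R := k) a) :=
    fun a => DFunLike.congr_fun hΔi a
  have hΔj' : ∀ a, ΔP (j a) = Algebra.TensorProduct.map j j (Coalgebra.comul (R := k) a) :=
    fun a => DFunLike.congr_fun hΔj a
  have hεi' : ∀ a, εP (i a) = Coalgebra.counit (R := k) a := fun a => DFunLike.congr_fun hεi a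
  have hεj' : ∀ a, εP (j a) = Coalgebra.counit (R := k) a := fun a => DFunLike.congr_fun hεj a
  refine ⟨?_, ?_⟩
  · obtain ⟨χ, ⟨h1, h2⟩, -⟩ := hP Pᵐᵒᵖ inferInstance inferInstance (opAntipode i) (opAntipode j)
    refine ⟨(MulOpposite.opLinearEquiv k).symm.toLinearMap ∘ₗ χ.toLinearMap,
      ⟨⟨by simp, fun x y => by simp⟩, ?_, ?_⟩, ?_⟩
    · ext a
      exact congrArg MulOpposite.unop (DFunLike.congr_fun h1 a)
    · ext a
      exact congrArg MulOpposite.unop (DFunLike.congr_fun h2 a)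
    · rintro S ⟨⟨hS1, hS⟩, hSi, hSj⟩
      have e : AlgHom.ofLinearMap ((MulOpposite.opLinearEquiv k).toLinearMap ∘ₗ S)
          (by simp [hS1]) (by intro x y; simp [hS]) = χ := by
        refine (hP Pᵐᵒᵖ inferInstance inferInstance (opAntipode i) (opAntipode j)).unique
          ⟨?_, ?_⟩ ⟨h1, h2⟩
        · ext a
          exact congrArg MulOpposite.op (LinearMap.congr_fun hSi a)
        · ext a
          exact congrArg MulOpposite.op (LinearMap.congr_fun hSj a)
      ext p
      rw [← e]
      rfl
  · rintro S ⟨hS1, hS⟩ hSi hSj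
    constructor
    · ext p
      let Q : Subalgebra k P :=
        { carrier := {p | LinearMap.mul' k P (S.rTensor P (ΔP p)) = algebraMap k P (εP p)}
          mul_mem' := by
            intro x y hx hy
            simp only [Set.mem_ofPred_eq] at hx hy ⊢
            rw [map_mul ΔP, map_mul εP]
            exact left_conv_mul S hS _ _ _ _ hx hy
          add_mem' := by
            intro x y hx hy
            simp only [Set.mem_ofPred_eq] at hx hy ⊢
            simp only [map_add, hx, hy]
          algebraMap_mem' := by
            intro r
            simp only [Set.mem_ofPred_eq, AlgHom.commutes, Algebra.TensorProduct.algebraMap_apply]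
            simp [Algebra.algebraMap_eq_smul_one, hS1] }
      refine cop_induction i j hP Q (fun a => ?_) (fun a => ?_) p
      · change LinearMap.mul' k P (S.rTensor P (ΔP (i a))) = algebraMap k P (εP (i a))
        rw [hΔi', hεi']
        exact left_conv_gen i S hSi a
      · change LinearMap.mul' k P (S.rTensor P (ΔP (j a))) = algebraMap k P (εP (j a))
        rw [hΔj', hεj']
        exact left_conv_gen j S hSj a
    · ext p
      let Q : Subalgebra k P :=
        { carrier := {p | LinearMap.mul' k P (S.lTensor P (ΔP p)) = algebraMap k P (εP p)}
          mul_mem' := by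
            intro x y hx hy
            simp only [Set.mem_ofPred_eq] at hx hy ⊢
            rw [map_mul ΔP, map_mul εP]
            exact right_conv_mul S hS _ _ _ _ hx hy
          add_mem' := by
            intro x y hx hy
            simp only [Set.mem_ofPred_eq] at hx hy ⊢
            simp only [map_add, hx, hy]
          algebraMap_mem' := by
            intro r
            simp only [Set.mem_ofPred_eq, AlgHom.commutes, Algebra.TensorProduct.algebraMap_apply]
            simp [Algebra.algebraMap_eq_smul_one, hS1] }
      refine cop_induction i j hP Q (fun a => ?_) (fun a => ?_) p
      · change LinearMap.mul' k P (S.lTensor P (ΔP (i a))) = algebraMap k P (εP (i a))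
        rw [hΔi', hεi']
        exact right_conv_gen i S hSi a
      · change LinearMap.mul' k P (S.lTensor P (ΔP (j a))) = algebraMap k P (εP (j a))
        rw [hΔj', hεj']
        exact right_conv_gen j S hSj a
end

section
/- The category of Hopf algebras over a field k has binary coproducts: for any two Hopf algebras A and B over k there exist a Hopf algebra P and Hopf algebra homomorphisms i : A → P and j : B → P such that for every Hopf algebra R over k and every pair of Hopf algebra homomorphisms φ : A → R, ψ : B → R there is a unique Hopf algebra homomorphism χ : P → R with χ ∘ i = φ and χ ∘ j = ψ. -/
universe u

open TensorProduct

namespace HopfCoprod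

section alg

variable (k : Type u) [Field k] (A B : Type u) [Semiring A] [Semiring B]
  [Algebra k A] [Algebra k B]

/-- Relations defining the free product of two algebras. -/
inductive Rel : TensorAlgebra k (A × B) → TensorAlgebra k (A × B) → Prop
  | onel : Rel (TensorAlgebra.ι k (1, 0)) 1
  | oner : Rel (TensorAlgebra.ι k (0, 1)) 1
  | mull (a a' : A) : Rel (TensorAlgebra.ι k (a * a', 0))
      (TensorAlgebra.ι k (a, 0) * TensorAlgebra.ι k (a', 0))
  | mulr (b b' : B) : Rel (TensorAlgebra.ι k (0, b * b'))
      (TensorAlgebra.ι k (0, b) * TensorAlgebra.ι k (0, b'))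

theorem exists_alg_coprod : ∃ (P : Type u) (_ : Semiring P) (_ : Algebra k P)
    (i : A →ₐ[k] P) (j : B →ₐ[k] P),
    ∀ (T : Type u) (_ : Semiring T) (_ : Algebra k T) (f : A →ₐ[k] T) (g : B →ₐ[k] T),
      ∃! h : P →ₐ[k] T, h.comp i = f ∧ h.comp j = g := by
  let q := RingQuot.mkAlgHom k (Rel k A B)
  let i : A →ₐ[k] RingQuot (Rel k A B) := AlgHom.ofLinearMap
    (q.toLinearMap ∘ₗ TensorAlgebra.ι k ∘ₗ LinearMap.inl k A B)
    (by simpa [q] using RingQuot.mkAlgHom_rel k (Rel.onel (k := k) (A := A) (B := B)))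
    (fun a a' => by
      simpa [q] using RingQuot.mkAlgHom_rel k (Rel.mull (k := k) (A := A) (B := B) a a'))
  let j : B →ₐ[k] RingQuot (Rel k A B) := AlgHom.ofLinearMap
    (q.toLinearMap ∘ₗ TensorAlgebra.ι k ∘ₗ LinearMap.inr k A B)
    (by simpa [q] using RingQuot.mkAlgHom_rel k (Rel.oner (k := k) (A := A) (B := B)))
    (fun a a' => by
      simpa [q] using RingQuot.mkAlgHom_rel k (Rel.mulr (k := k) (A := A) (B := B) a a'))
  refine ⟨RingQuot (Rel k A B), inferInstance, inferInstance, i, j, ?_⟩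
  intro T _ _ f g
  let l : TensorAlgebra k (A × B) →ₐ[k] T :=
    TensorAlgebra.lift k (LinearMap.coprod f.toLinearMap g.toLinearMap)
  have hl : ∀ ⦃x y⦄, Rel k A B x y → l x = l y := by
    intro x y h
    cases h <;> simp [l]
  refine ⟨RingQuot.liftAlgHom k ⟨l, hl⟩, ⟨?_, ?_⟩, ?_⟩
  · ext a; simp [i, q, l]
  · ext a; simp [j, q, l]
  · rintro h ⟨h1, h2⟩
    apply RingQuot.ringQuot_ext'
    apply TensorAlgebra.hom_ext
    apply LinearMap.prod_ext
    · ext a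
      simpa [i, q, l] using DFunLike.congr_fun h1 a
    · ext a
      simpa [j, q, l] using DFunLike.congr_fun h2 a

end alg

section aux

variable {k : Type u} [Field k] {A P : Type u} [Semiring A] [Bialgebra k A]
  [Semiring P] [Algebra k P]

open Algebra.TensorProduct in
theorem coassoc_aux (i : A →ₐ[k] P) (D : P →ₐ[k] P ⊗[k] P)
    (h : D.comp i = (map i i).comp (Bialgebra.comulAlgHom k A)) :
    ((Algebra.TensorProduct.assoc k k k P P P).toAlgHom.comp
      ((map D (.id k P)).comp D)).comp i = ((map (.id k P) D).comp D).comp i := by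
  have h1 : (map D (.id k P)).comp (map i i) =
      (map (map i i) i).comp (map (Bialgebra.comulAlgHom k A) (.id k A)) := by
    rw [← Algebra.TensorProduct.map_comp, ← Algebra.TensorProduct.map_comp, h]; rfl
  have h2 : (map (.id k P) D).comp (map i i) =
      (map i (map i i)).comp (map (.id k A) (Bialgebra.comulAlgHom k A)) := by
    rw [← Algebra.TensorProduct.map_comp, ← Algebra.TensorProduct.map_comp, h]; rfl
  have h3 : (Algebra.TensorProduct.assoc k k k P P P).toAlgHom.comp (map (map i i) i) =
      (map i (map i i)).comp (Algebra.TensorProduct.assoc k k k A A A).toAlgHom := by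
    ext <;> simp [Algebra.TensorProduct.one_def]
  have h4 : (Algebra.TensorProduct.assoc k k k A A A).toAlgHom.comp
      ((map (Bialgebra.comulAlgHom k A) (.id k A)).comp (Bialgebra.comulAlgHom k A)) =
      (map (.id k A) (Bialgebra.comulAlgHom k A)).comp (Bialgebra.comulAlgHom k A) := by
    ext a
    exact Coalgebra.coassoc_apply a
  rw [AlgHom.comp_assoc, AlgHom.comp_assoc, AlgHom.comp_assoc, h,
    ← AlgHom.comp_assoc _ (map i i), ← AlgHom.comp_assoc _ (map i i), h1, h2,
    AlgHom.comp_assoc, AlgHom.comp_assoc, ← AlgHom.comp_assoc _ (map (map i i) i), h3,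
    AlgHom.comp_assoc, h4]

open Algebra.TensorProduct in
theorem rTensor_aux (i : A →ₐ[k] P) (D : P →ₐ[k] P ⊗[k] P) (e : P →ₐ[k] k)
    (h : D.comp i = (map i i).comp (Bialgebra.comulAlgHom k A))
    (he : e.comp i = Bialgebra.counitAlgHom k A) :
    ((map e (.id k P)).comp D).comp i =
      ((Algebra.TensorProduct.lid k P).symm : P →ₐ[k] k ⊗[k] P).comp i := by
  have h1 : (map e (.id k P)).comp (map i i) =
      (map (.id k k) i).comp (map (Bialgebra.counitAlgHom k A) (.id k A)) := by
    rw [← Algebra.TensorProduct.map_comp, ← Algebra.TensorProduct.map_comp, he]; rfl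
  rw [AlgHom.comp_assoc, h, ← AlgHom.comp_assoc, h1]
  ext a
  have := Coalgebra.rTensor_counit_comul (R := k) a
  have h2 : map (Bialgebra.counitAlgHom k A) (.id k A) (Coalgebra.comul (R := k) a)
     = 1 ⊗ₜ a := this
  simp [h2]

open Algebra.TensorProduct in
theorem lTensor_aux (i : A →ₐ[k] P) (D : P →ₐ[k] P ⊗[k] P) (e : P →ₐ[k] k)
    (h : D.comp i = (map i i).comp (Bialgebra.comulAlgHom k A))
    (he : e.comp i = Bialgebra.counitAlgHom k A) :
    ((map (.id k P) e).comp D).comp i =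
      ((Algebra.TensorProduct.rid k k P).symm : P →ₐ[k] P ⊗[k] k).comp i := by
  have h1 : (map (.id k P) e).comp (map i i) =
      (map i (.id k k)).comp (map (.id k A) (Bialgebra.counitAlgHom k A)) := by
    rw [← Algebra.TensorProduct.map_comp, ← Algebra.TensorProduct.map_comp, he]; rfl
  rw [AlgHom.comp_assoc, h, ← AlgHom.comp_assoc, h1]
  ext a
  have := Coalgebra.lTensor_counit_comul (R := k) a
  have h2 : map (.id k A) (Bialgebra.counitAlgHom k A) (Coalgebra.comul (R := k) a)
     = a ⊗ₜ 1 := this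
  simp [h2]

end aux

section anti

variable {k : Type u} [Field k] {P : Type u} [Semiring P] [Algebra k P]

theorem left_aux (S : P →ₗ[k] P) (hS : ∀ x y, S (x * y) = S y * S x) (t u : P ⊗[k] P) (r : k)
    (ht : LinearMap.mul' k P (S.rTensor P t) = algebraMap k P r) :
    LinearMap.mul' k P (S.rTensor P (t * u)) = r • LinearMap.mul' k P (S.rTensor P u) := by
  induction u with
  | zero => simp
  | add x y hx hy => simp only [mul_add, map_add, hx, hy, smul_add]
  | tmul b c =>
    have key : LinearMap.mul' k P (S.rTensor P (t * (b ⊗ₜ c))) =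
        S b * LinearMap.mul' k P (S.rTensor P t) * c := by
      clear ht
      induction t with
      | zero => simp
      | add x y hx hy => simp only [add_mul, mul_add, map_add, hx, hy]
      | tmul x y => simp [hS, mul_assoc]
    rw [key, ht, ← Algebra.commutes, mul_assoc, ← Algebra.smul_def]
    simp

theorem right_aux (S : P →ₗ[k] P) (hS : ∀ x y, S (x * y) = S y * S x) (t u : P ⊗[k] P) (r : k)
    (hu : LinearMap.mul' k P (S.lTensor P u) = algebraMap k P r) :
    LinearMap.mul' k P (S.lTensor P (t * u)) = r • LinearMap.mul' k P (S.lTensor P t) := by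
  induction t with
  | zero => simp
  | add x y hx hy => simp only [add_mul, map_add, hx, hy, smul_add]
  | tmul b c =>
    have key : LinearMap.mul' k P (S.lTensor P ((b ⊗ₜ c) * u)) =
        b * LinearMap.mul' k P (S.lTensor P u) * S c := by
      clear hu
      induction u with
      | zero => simp
      | add x y hx hy => simp only [add_mul, mul_add, map_add, hx, hy]
      | tmul x y => simp [hS, mul_assoc]
    rw [key, hu, ← Algebra.commutes, mul_assoc, ← Algebra.smul_def]
    simp

end anti

section anti2

variable {k : Type u} [Field k] {P : Type u} [Semiring P] [Bialgebra k P]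

/-- The subalgebra where the antipode axioms hold. -/
def good (S : P →ₗ[k] P) (h1 : S 1 = 1) (hS : ∀ x y, S (x * y) = S y * S x) :
    Subalgebra k P where
  carrier := {x | LinearMap.mul' k P (S.rTensor P (Coalgebra.comul x)) =
      algebraMap k P (Coalgebra.counit x) ∧
    LinearMap.mul' k P (S.lTensor P (Coalgebra.comul x)) =
      algebraMap k P (Coalgebra.counit x)}
  mul_mem' := by
    rintro x y ⟨hx, hx'⟩ ⟨hy, hy'⟩
    constructor
    · rw [Bialgebra.comul_mul, left_aux S hS _ _ _ hx, hy, Bialgebra.counit_mul, map_mul,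
        Algebra.smul_def]
    · rw [Bialgebra.comul_mul, right_aux S hS _ _ _ hy', hx', Bialgebra.counit_mul, mul_comm,
        map_mul, Algebra.smul_def]
  add_mem' := by
    rintro x y ⟨hx, hx'⟩ ⟨hy, hy'⟩
    constructor
    · simp only [map_add, hx, hy]
    · simp only [map_add, hx', hy']
  algebraMap_mem' r := by
    constructor <;>
      simp [Algebra.TensorProduct.one_def, Algebra.algebraMap_eq_smul_one, h1]

theorem good_of_hom {A : Type u} [Semiring A] [HopfAlgebra k A]
    (S : P →ₗ[k] P) (h1 : S 1 = 1) (hS : ∀ x y, S (x * y) = S y * S x) (i : A →ₐc[k] P)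
    (hi : ∀ a, S (i a) = i (HopfAlgebra.antipode k a)) (a : A) : i a ∈ good S h1 hS := by
  have hc : Coalgebra.comul (R := k) (i a) =
      TensorProduct.map (i : A →ₗ[k] P) (i : A →ₗ[k] P) (Coalgebra.comul a) :=
    (CoalgHomClass.map_comp_comul_apply i a).symm
  have he : Coalgebra.counit (R := k) (i a) = Coalgebra.counit (R := k) a :=
    CoalgHomClass.counit_comp_apply i a
  constructor
  · have key : ∀ t : A ⊗[k] A, LinearMap.mul' k P (S.rTensor P
        (TensorProduct.map (i : A →ₗ[k] P) (i : A →ₗ[k] P) t)) =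
        i (LinearMap.mul' k A ((HopfAlgebra.antipode k).rTensor A t)) := by
      intro t
      induction t with
      | zero => simp
      | add x y hx hy => simp only [map_add, hx, hy]
      | tmul x y => simp [hi]
    rw [hc, he, key, HopfAlgebra.mul_antipode_rTensor_comul_apply]
    exact AlgHomClass.commutes i _
  · have key : ∀ t : A ⊗[k] A, LinearMap.mul' k P (S.lTensor P
        (TensorProduct.map (i : A →ₗ[k] P) (i : A →ₗ[k] P) t)) =
        i (LinearMap.mul' k A ((HopfAlgebra.antipode k).lTensor A t)) := by
      intro t
      induction t with
      | zero => simp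
      | add x y hx hy => simp only [map_add, hx, hy]
      | tmul x y => simp [hi]
    rw [hc, he, key, HopfAlgebra.mul_antipode_lTensor_comul_apply]
    exact AlgHomClass.commutes i _

end anti2

end HopfCoprod

open HopfCoprod in
/-- The category of Hopf algebras over a field `k` has binary coproducts: for Hopf algebras
`A`, `B` there are a Hopf algebra `P` and Hopf algebra morphisms (= bialgebra morphisms)
`i : A → P`, `j : B → P` through which every pair of Hopf algebra morphisms to any Hopf
algebra `R` factors uniquely. -/
theorem hopf_algebras_have_binary_coproducts
    (k : Type u) [Field k] (A B : Type u) [Ring A] [Ring B]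
    [HopfAlgebra k A] [HopfAlgebra k B] :
    ∃ (P : Type u) (_ : Semiring P) (_ : HopfAlgebra k P),
      ∃ (i : A →ₐc[k] P) (j : B →ₐc[k] P),
        ∀ (R : Type u) (_ : Semiring R) (_ : HopfAlgebra k R)
          (φ : A →ₐc[k] R) (ψ : B →ₐc[k] R),
          ∃! χ : P →ₐc[k] R, χ.comp i = φ ∧ χ.comp j = ψ := by
  obtain ⟨P, _, _, i, j, H⟩ := exists_alg_coprod k A B
  have hext : ∀ {T : Type u} [Semiring T] [Algebra k T] (f g : P →ₐ[k] T),
      f.comp i = g.comp i → f.comp j = g.comp j → f = g := by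
    intro T _ _ f g h1 h2
    exact (H T _ _ (g.comp i) (g.comp j)).unique ⟨h1, h2⟩ ⟨rfl, rfl⟩
  obtain ⟨D, ⟨hDi, hDj⟩, -⟩ := H (P ⊗[k] P) _ _
    ((Algebra.TensorProduct.map i i).comp (Bialgebra.comulAlgHom k A))
    ((Algebra.TensorProduct.map j j).comp (Bialgebra.comulAlgHom k B))
  obtain ⟨e, ⟨hei, hej⟩, -⟩ := H k _ _ (Bialgebra.counitAlgHom k A) (Bialgebra.counitAlgHom k B)
  obtain ⟨S, ⟨hSi, hSj⟩, -⟩ := H Pᵐᵒᵖ _ _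
    ((AlgHom.op i).comp (HopfAlgebra.antipodeAlgHomOp k A))
    ((AlgHom.op j).comp (HopfAlgebra.antipodeAlgHomOp k B))
  let bi : Bialgebra k P := Bialgebra.ofAlgHom D e
    (hext _ _ (coassoc_aux i D hDi) (coassoc_aux j D hDj))
    (hext _ _ (rTensor_aux i D e hDi hei) (rTensor_aux j D e hDj hej))
    (hext _ _ (lTensor_aux i D e hDi hei) (lTensor_aux j D e hDj hej))
  let i' : A →ₐc[k] P := BialgHom.ofAlgHom i hei hDi.symm
  let j' : B →ₐc[k] P := BialgHom.ofAlgHom j hej hDj.symm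
  let S' : P →ₗ[k] P := (MulOpposite.opLinearEquiv k).symm.toLinearMap ∘ₗ S.toLinearMap
  have hS1 : S' 1 = 1 := by simp [S']
  have hSm : ∀ x y, S' (x * y) = S' y * S' x := by simp [S']
  have hgi : ∀ a, i a ∈ good S' hS1 hSm := good_of_hom S' hS1 hSm i' (fun a =>
    congrArg MulOpposite.unop (DFunLike.congr_fun hSi a))
  have hgj : ∀ a, j a ∈ good S' hS1 hSm := good_of_hom S' hS1 hSm j' (fun a =>
    congrArg MulOpposite.unop (DFunLike.congr_fun hSj a))
  have hg : ∀ x, x ∈ good S' hS1 hSm := by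
    obtain ⟨l, ⟨hl1, hl2⟩, -⟩ := H (good S' hS1 hSm) _ _ (i.codRestrict _ hgi)
      (j.codRestrict _ hgj)
    have : (good S' hS1 hSm).val.comp l = AlgHom.id k P := by
      apply hext
      · rw [AlgHom.comp_assoc, hl1]; rfl
      · rw [AlgHom.comp_assoc, hl2]; rfl
    intro x
    have hx : ((l x : good S' hS1 hSm) : P) = x := DFunLike.congr_fun this x
    rw [← hx]
    exact (l x).2
  let hopf : HopfAlgebra k P :=
    { bi with
      antipode := S'
      mul_antipode_rTensor_comul := LinearMap.ext fun x => (hg x).1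
      mul_antipode_lTensor_comul := LinearMap.ext fun x => (hg x).2 }
  refine ⟨P, inferInstance, hopf, i', j', ?_⟩
  intro R _ _ φ ψ
  obtain ⟨χ, ⟨h1, h2⟩, -⟩ := H R _ _ (φ : A →ₐ[k] R) (ψ : B →ₐ[k] R)
  have hc1 : (Bialgebra.counitAlgHom k R).comp χ = e := by
    apply hext
    · rw [AlgHom.comp_assoc, h1, hei, BialgHom.counitAlgHom_comp]
    · rw [AlgHom.comp_assoc, h2, hej, BialgHom.counitAlgHom_comp]
  have hc2 : (Algebra.TensorProduct.map χ χ).comp D = (Bialgebra.comulAlgHom k R).comp χ := by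
    apply hext
    · rw [AlgHom.comp_assoc, hDi, AlgHom.comp_assoc, h1, ← AlgHom.comp_assoc,
        ← Algebra.TensorProduct.map_comp, h1, BialgHom.map_comp_comulAlgHom]
    · rw [AlgHom.comp_assoc, hDj, AlgHom.comp_assoc, h2, ← AlgHom.comp_assoc,
        ← Algebra.TensorProduct.map_comp, h2, BialgHom.map_comp_comulAlgHom]
  refine ⟨BialgHom.ofAlgHom χ hc1 hc2, ⟨?_, ?_⟩, ?_⟩
  · ext a; exact DFunLike.congr_fun h1 a
  · ext a; exact DFunLike.congr_fun h2 a
  · rintro χ' ⟨g1, g2⟩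
    have : (χ' : P →ₐ[k] R) = χ := by
      apply hext
      · rw [h1, ← g1]; rfl
      · rw [h2, ← g2]; rfl
    ext x
    exact DFunLike.congr_fun this x
end

section
/- Let k be an algebraically closed field of characteristic p > 0 and let A be a finite-dimensional commutative local k-algebra with residue field k and maximal ideal 𝔪 ≠ 0 such that a^p = 0 for every a ∈ 𝔪. Let T(𝔪^*) carry the bialgebra structure in which Δ(x) = x ⊗ 1 + 1 ⊗ x + Δ_0(x) and ε(x) = 0 for x ∈ 𝔪^*, where Δ_0 is the transpose of the multiplication 𝔪 ⊗ 𝔪 → 𝔪. Then T(𝔪^*) is isomorphic, as a bialgebra over k, to the free associative algebra k⟨x_1, …, x_n⟩ on n = dim_k 𝔪 generators equipped with the bialgebra structure in which each generator x_i is primitive, i.e. Δ(x_i) = x_i ⊗ 1 + 1 ⊗ x_i and ε(x_i) = 0 (that is, T(𝔪^*) is the universal enveloping algebra of the free Lie algebra on dim_k 𝔪 generators). -/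
open TensorProduct

noncomputable section

/-- Given a finite-dimensional `k`-vector space `m` with a bilinear multiplication `μ`, the
map `Δ₀ : m^* → m^* ⊗ m^*` obtained as the transpose of the multiplication map
`m ⊗ m → m` (using the canonical isomorphism `(m ⊗ m)^* ≅ m^* ⊗ m^*`). -/
noncomputable def transposeComul (k m : Type*) [Field k] [AddCommGroup m] [Module k m]
    [FiniteDimensional k m] (μ : m →ₗ[k] m →ₗ[k] m) :
    Module.Dual k m →ₗ[k] Module.Dual k m ⊗[k] Module.Dual k m :=
  (TensorProduct.dualDistribEquiv k m m).symm.toLinearMap ∘ₗ (TensorProduct.lift μ).dualMap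

/-- The multiplication of an ideal `I` of a commutative `k`-algebra `A`, as a `k`-bilinear
map on `I` (viewed as a `k`-vector space). -/
noncomputable def idealMulBilin (k A : Type*) [Field k] [CommRing A] [Algebra k A]
    (I : Ideal A) :
    ↥(I.restrictScalars k) →ₗ[k] ↥(I.restrictScalars k) →ₗ[k] ↥(I.restrictScalars k) :=
  LinearMap.mk₂ k (fun x y => ⟨x.1 * y.1, I.mul_mem_left x.1 y.2⟩)
    (fun x x' y => Subtype.ext (add_mul x.1 x'.1 y.1))
    (fun c x y => Subtype.ext (smul_mul_assoc c x.1 y.1))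
    (fun x y y' => Subtype.ext (mul_add x.1 y.1 y'.1))
    (fun c x y => Subtype.ext (mul_smul_comm c x.1 y.1))

theorem aux_basis {k V : Type*} [Field k] [AddCommGroup V] [Module k V] [FiniteDimensional k V]
    (Fil : ℕ → Submodule k V) (hanti : Antitone Fil) (h0 : Fil 0 = ⊤) (N : ℕ) (hN : Fil N = ⊥) :
    ∃ b : Module.Basis (Fin (Module.finrank k V)) k V,
      ∀ t x, x ∈ Fil t → ∀ j, b.coord j x ≠ 0 → b j ∈ Fil t := by
  classical
  have key : ∀ d ≤ N, ∃ s : Set V, LinearIndepOn k id s ∧ s ⊆ Fil (N - d) ∧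
      ∀ t, N - d ≤ t → Fil t ≤ Submodule.span k (s ∩ Fil t) := by
    intro d
    induction d with
    | zero =>
      intro _
      refine ⟨∅, linearIndepOn_empty _ _, by simp, fun t ht => ?_⟩
      have : Fil t ≤ ⊥ := hN ▸ hanti (by simpa using ht)
      exact this.trans bot_le
    | succ d ih =>
      intro hd
      obtain ⟨s, hs, hsF, hsp⟩ := ih (by omega)
      have hle : N - (d+1) ≤ N - d := by omega
      obtain ⟨b, hb, hsb, htb, hlb⟩ := exists_linearIndepOn_id_extension hs
        (hsF.trans (SetLike.coe_subset_coe.2 (hanti hle)))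
      refine ⟨b, hlb, hb, fun t ht => ?_⟩
      by_cases h : N - d ≤ t
      · exact (hsp t h).trans (Submodule.span_mono (Set.inter_subset_inter_left _ hsb))
      · have : t = N - (d+1) := by omega
        subst this
        rw [Set.inter_eq_left.2 hb]
        exact htb
  obtain ⟨s, hs, -, hsp⟩ := key N le_rfl
  simp only [Nat.sub_self, Nat.zero_le, forall_const] at hsp
  have hspan : ⊤ ≤ Submodule.span k (Set.range ((↑) : s → V)) := by
    rw [← h0, Subtype.range_coe]
    exact (hsp 0).trans (Submodule.span_mono Set.inter_subset_left)
  let b0 : Module.Basis s k V := Module.Basis.mk hs hspan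
  have hb0 : ∀ i, b0 i = i := fun i => by simp [b0]
  have : Fintype s := FiniteDimensional.fintypeBasisIndex b0
  have hcard : Fintype.card s = Module.finrank k V := (Module.finrank_eq_card_basis b0).symm
  let eqv : s ≃ Fin (Module.finrank k V) := Fintype.equivFinOfCardEq hcard
  have main0 : ∀ t x, x ∈ Fil t → ∀ j, b0.coord j x ≠ 0 → b0 j ∈ Fil t := by
    intro t x hx j hj
    by_contra hcon
    apply hj
    have hle : Submodule.span k (s ∩ Fil t) ≤ LinearMap.ker (b0.coord j) := by
      rw [Submodule.span_le]
      rintro y ⟨hy, hyt⟩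
      have hy' : y = b0 ⟨y, hy⟩ := (hb0 ⟨y, hy⟩).symm
      have hne : (⟨y, hy⟩ : s) ≠ j := by
        rintro rfl
        exact hcon (by rw [← hy']; exact hyt)
      show b0.coord j y = 0
      rw [hy', Module.Basis.coord_apply, Module.Basis.repr_self, Finsupp.single_apply, if_neg hne]
    exact hle (hsp t hx)
  refine ⟨b0.reindex eqv, fun t x hx j hj => ?_⟩
  rw [Module.Basis.reindex_apply]
  exact main0 t x hx _ (by simpa using hj)

theorem aux_basis_weight {k V : Type*} [Field k] [AddCommGroup V] [Module k V]
    [FiniteDimensional k V] (μ : V →ₗ[k] V →ₗ[k] V)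
    (Fil : ℕ → Submodule k V) (hanti : Antitone Fil) (h0 : Fil 0 = ⊤) (N : ℕ) (hN : Fil N = ⊥)
    (hμ : ∀ t x, x ∈ Fil t → ∀ y, μ x y ∈ Fil (t+1)) :
    ∃ (b : Module.Basis (Fin (Module.finrank k V)) k V) (w : Fin (Module.finrank k V) → ℕ),
      ∀ i x j, b.coord j (μ (b i) x) ≠ 0 → w i < w j := by
  classical
  obtain ⟨b, hb⟩ := aux_basis Fil hanti h0 N hN
  refine ⟨b, fun i => Nat.findGreatest (fun t => b i ∈ Fil t) N, fun i x j hj => ?_⟩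
  have h1 : b i ∈ Fil (Nat.findGreatest (fun t => b i ∈ Fil t) N) :=
    Nat.findGreatest_spec (P := fun t => b i ∈ Fil t) (Nat.zero_le N) (by rw [h0]; trivial)
  have h2 := hb _ _ (hμ _ _ h1 x) j hj
  have h3 := Nat.findGreatest_le (P := fun t => b i ∈ Fil t) N
  have h4 : Nat.findGreatest (fun t => b i ∈ Fil t) N ≠ N := by
    intro h
    rw [h, hN] at h1
    exact b.ne_zero i ((Submodule.mem_bot k).1 h1)
  exact Nat.le_findGreatest (P := fun t => b j ∈ Fil t) (Nat.lt_of_le_of_ne h3 h4) h2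

/-- triangular endomorphisms of the free algebra are bijective -/
theorem aux_triang {k ι : Type*} [Field k] [Fintype ι] (w : ι → ℕ)
    (r : ι → FreeAlgebra k ι)
    (hr : ∀ j, r j ∈ Algebra.adjoin k (FreeAlgebra.ι k '' {i | w i < w j})) :
    Function.Bijective (FreeAlgebra.lift k (fun j => FreeAlgebra.ι k j + r j)) := by
  set ψ := FreeAlgebra.lift k (fun j => FreeAlgebra.ι k j + r j) with hψ
  have hψι : ∀ j, ψ (FreeAlgebra.ι k j) = FreeAlgebra.ι k j + r j := fun j => by simp [hψ]
  constructor
  · let χ : ℕ → (FreeAlgebra k ι →ₐ[k] FreeAlgebra k ι) := fun s => Nat.rec (AlgHom.id k _)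
      (fun _ f => FreeAlgebra.lift k (fun j => FreeAlgebra.ι k j - f (r j))) s
    have hχ : ∀ s j, χ (s+1) (FreeAlgebra.ι k j) = FreeAlgebra.ι k j - χ s (r j) := by
      intro s j
      show FreeAlgebra.lift k (fun j => FreeAlgebra.ι k j - χ s (r j)) (FreeAlgebra.ι k j) = _
      simp
    clear_value χ
    have hagree : ∀ (f g : FreeAlgebra k ι →ₐ[k] FreeAlgebra k ι) (j : ι),
        (∀ i, w i < w j → f (FreeAlgebra.ι k i) = g (FreeAlgebra.ι k i)) → f (r j) = g (r j) := by
      intro f g j h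
      have hle : Algebra.adjoin k (FreeAlgebra.ι k '' {i | w i < w j}) ≤ AlgHom.equalizer f g := by
        rw [Algebra.adjoin_le_iff]
        rintro _ ⟨i, hi, rfl⟩
        exact h i hi
      exact hle (hr j)
    have hst : ∀ s i, w i < s → χ s (FreeAlgebra.ι k i) = χ (s+1) (FreeAlgebra.ι k i) := by
      intro s
      induction s with
      | zero => intro i hi; omega
      | succ s ih =>
        intro i hi
        rw [hχ, hχ, hagree (χ s) (χ (s+1)) i fun l hl => ih l (by omega)]
    obtain ⟨N, hN⟩ : ∃ N, ∀ i, w i < N :=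
      ⟨Finset.univ.sup w + 1, fun i => Nat.lt_succ_of_le (Finset.le_sup (Finset.mem_univ i))⟩
    have hcomp : (χ N).comp ψ = AlgHom.id k _ := by
      apply FreeAlgebra.hom_ext
      funext j
      simp only [Function.comp_apply, AlgHom.comp_apply, hψι, map_add, AlgHom.id_apply]
      rw [hst N j (hN j), hχ]
      simp
    intro x y hxy
    have := congrArg (χ N) hxy
    simpa only [← AlgHom.comp_apply, hcomp, AlgHom.id_apply] using this
  · rw [← AlgHom.range_eq_top, eq_top_iff, ← FreeAlgebra.adjoin_range_ι, Algebra.adjoin_le_iff]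
    rintro _ ⟨j, rfl⟩
    induction hn : w j using Nat.strong_induction_on generalizing j with
    | _ n ih =>
    subst hn
    have h1 : r j ∈ ψ.range := by
      have hle : Algebra.adjoin k (FreeAlgebra.ι k '' {i | w i < w j}) ≤ ψ.range := by
        rw [Algebra.adjoin_le_iff]
        rintro _ ⟨i, hi, rfl⟩
        exact ih _ hi i rfl
      exact hle (hr j)
    have h2 : ψ (FreeAlgebra.ι k j) ∈ ψ.range := ⟨_, rfl⟩
    rw [hψι] at h2
    simpa using sub_mem h2 h1

/-- truncated exponential -/
noncomputable def texp (k : Type*) {B : Type*} [Field k] [Ring B] [Algebra k B] (p : ℕ) (x : B) : B :=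
  ∑ n ∈ Finset.range p, ((n.factorial : k)⁻¹) • x ^ n

theorem texp_map {k B C : Type*} [Field k] [Ring B] [Algebra k B] [Ring C] [Algebra k C]
    (p : ℕ) (f : B →ₐ[k] C) (x : B) : f (texp k p x) = texp k p (f x) := by
  simp [texp]

theorem texp_add {k B : Type*} [Field k] [Ring B] [Algebra k B] (p : ℕ) (hp : p.Prime) [CharP k p]
    (x y : B) (hc : Commute x y) (h : ∀ i j, p ≤ i + j → x ^ i * y ^ j = 0) :
    texp k p (x + y) = texp k p x * texp k p y := by
  have hf : ∀ n < p, (n.factorial : k) ≠ 0 := fun n hn => by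
    rw [Ne, CharP.cast_eq_zero_iff k p, hp.dvd_factorial]; omega
  unfold texp
  rw [Finset.sum_mul_sum, ← Finset.sum_product']
  have h1 : ∀ n ∈ Finset.range p, ((n.factorial : k)⁻¹) • (x + y) ^ n =
      ∑ ij ∈ Finset.HasAntidiagonal.antidiagonal n, (((ij.1.factorial : k)⁻¹) • x ^ ij.1) *
        (((ij.2.factorial : k)⁻¹) • y ^ ij.2) := by
    intro n hn
    rw [hc.add_pow', Finset.smul_sum]
    refine Finset.sum_congr rfl fun ij hij => ?_
    rw [Finset.HasAntidiagonal.mem_antidiagonal] at hij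
    rw [Finset.mem_range] at hn
    rw [smul_mul_smul_comm, ← Nat.cast_smul_eq_nsmul k, smul_smul]
    congr 1
    have e0 : n.choose ij.1 = n.choose ij.2 := by
      rw [← hij, Nat.choose_symm_add]
    rw [e0]
    have e := Nat.add_choose_mul_factorial_mul_factorial ij.1 ij.2
    rw [hij] at e
    have e' : ((n.choose ij.2 : k)) * ij.1.factorial * ij.2.factorial = n.factorial := by
      rw [← e]; push_cast; rfl
    have a1 := hf n hn
    have a2 := hf ij.1 (by omega)
    have a3 := hf ij.2 (by omega)
    field_simp
    rw [← e']
    try ring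
  rw [Finset.sum_congr rfl h1, Finset.sum_sigma']
  refine Finset.sum_of_injOn (fun z => z.2) ?_ ?_ ?_ ?_
  · rintro ⟨n, a, b⟩ hz ⟨n', a', b'⟩ hz' heq
    simp at hz hz' heq
    obtain ⟨rfl, rfl⟩ := heq
    obtain ⟨_, rfl⟩ := hz
    obtain ⟨_, rfl⟩ := hz'
    rfl
  · rintro ⟨n, a, b⟩ hz
    simp at hz ⊢
    omega
  · rintro ⟨a, b⟩ hz hz'
    simp at hz hz'
    rw [smul_mul_smul_comm, h a b, smul_zero]
    exact hz'
  · intros; rfl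

section RelGrp
variable {k A H ι : Type*} [Field k] [CommRing A] [Algebra k A] [Ring H] [Algebra k H] [Fintype ι]

/-- the element `1 + ∑ e_j ⊗ c_j` -/
noncomputable def UU (k : Type*) {A H ι : Type*} [Field k] [CommRing A] [Algebra k A] [Ring H]
    [Algebra k H] [Fintype ι] (e : ι → A) (c : ι → H) : A ⊗[k] H :=
  1 + ∑ j, e j ⊗ₜ[k] c j

theorem UU_mul (e : ι → A) (M : ι → ι → ι → k) (he : ∀ a b, e a * e b = ∑ j, M a b j • e j)
    (c c' : ι → H) : UU k e c * UU k e c' =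
      UU k e (fun j => c j + c' j + ∑ a, ∑ b, M a b j • (c a * c' b)) := by
  have h : (∑ j, e j ⊗ₜ[k] c j) * (∑ j, e j ⊗ₜ[k] c' j) =
      ∑ j, e j ⊗ₜ[k] (∑ a, ∑ b, M a b j • (c a * c' b)) := by
    rw [Finset.sum_mul_sum]
    simp only [Algebra.TensorProduct.tmul_mul_tmul, he, TensorProduct.sum_tmul,
      TensorProduct.tmul_sum, TensorProduct.smul_tmul]
    rw [Finset.sum_comm' (t' := Finset.univ) (s' := fun _ => Finset.univ) (by simp)]
    rw [Finset.sum_comm]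
    conv_rhs => rw [Finset.sum_comm]
    refine Finset.sum_congr rfl fun a _ => ?_
    rw [Finset.sum_comm]
  simp only [UU, TensorProduct.tmul_add, Finset.sum_add_distrib, ← h]
  noncomm_ring

theorem UU_map {H' : Type*} [Ring H'] [Algebra k H'] (f : H →ₐ[k] H') (e : ι → A) (c : ι → H) :
    Algebra.TensorProduct.map (AlgHom.id k A) f (UU k e c) = UU k e (fun j => f (c j)) := by
  simp [UU]

theorem UU_inj [DecidableEq ι] (e : ι → A)
    (hf : ∀ j, ∃ f : A →ₗ[k] k, f 1 = 0 ∧ ∀ i, f (e i) = if i = j then 1 else 0)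
    (c c' : ι → H) (h : UU k e c = UU k e c') (j : ι) : c j = c' j := by
  obtain ⟨f, hf1, hfe⟩ := hf j
  have := congrArg (fun z => TensorProduct.lid k H (f.rTensor H z)) h
  simpa [UU, Algebra.TensorProduct.one_def, hf1, hfe] using this

/-- grouplike elements relative to `A` -/
def RelGrp (Δ : H →ₐ[k] H ⊗[k] H) (u : A ⊗[k] H) : Prop :=
  Algebra.TensorProduct.map (AlgHom.id k A) Δ u =
    Algebra.TensorProduct.map (AlgHom.id k A) Algebra.TensorProduct.includeLeft u *
    Algebra.TensorProduct.map (AlgHom.id k A) Algebra.TensorProduct.includeRight u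

theorem RelGrp_commute (u v : A ⊗[k] H) :
    Commute (Algebra.TensorProduct.map (AlgHom.id k A)
      (Algebra.TensorProduct.includeLeft : H →ₐ[k] H ⊗[k] H) u)
    (Algebra.TensorProduct.map (AlgHom.id k A)
      (Algebra.TensorProduct.includeRight : H →ₐ[k] H ⊗[k] H) v) := by
  induction u with
  | zero => simp
  | add x y hx hy => rw [map_add]; exact hx.add_left hy
  | tmul a x =>
    induction v with
    | zero => simp
    | add x y hx hy => rw [map_add]; exact hx.add_right hy
    | tmul b y =>
      simp [Commute, SemiconjBy, mul_comm a b]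

theorem RelGrp_mul (Δ : H →ₐ[k] H ⊗[k] H) (u v : A ⊗[k] H) (hu : RelGrp Δ u) (hv : RelGrp Δ v) :
    RelGrp Δ (u * v) := by
  unfold RelGrp at *
  rw [map_mul, hu, hv, map_mul, map_mul, (RelGrp_commute v u).symm.mul_mul_mul_comm]

theorem RelGrp_texp (p : ℕ) (hp : p.Prime) [CharP k p] (Δ : H →ₐ[k] H ⊗[k] H) (e : A) (he : e ^ p = 0)
    (y : H) (hy : Δ y = y ⊗ₜ 1 + 1 ⊗ₜ y) : RelGrp Δ (texp k p (e ⊗ₜ[k] y)) := by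
  unfold RelGrp
  rw [texp_map, texp_map, texp_map, ← texp_add p hp]
  · simp [hy, TensorProduct.tmul_add]
  · exact RelGrp_commute _ _
  · intro i j hij
    have : e ^ (i + j) = 0 := pow_eq_zero_of_le hij he
    simp [← pow_add, this, Algebra.TensorProduct.tmul_pow]

theorem texp_UU [DecidableEq ι] (e : ι → A) (M : ι → ι → ι → k)
    (he : ∀ a b, e a * e b = ∑ j, M a b j • e j)
    (w : ι → ℕ) (hw : ∀ a b j, M a b j ≠ 0 → w a < w j ∧ w b < w j)
    (p : ℕ) (hp : p.Prime) (ε : H →ₐ[k] k) (y : ι → H) (hε : ∀ i, ε (y i) = 0) (i : ι) :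
    ∃ d : ι → H, texp k p (e i ⊗ₜ[k] y i) = UU k e d ∧ (∀ j, ε (d j) = 0) ∧
      ∀ j, d j - (if j = i then y j else 0) ∈ Algebra.adjoin k (y '' {l | w l < w j}) := by
  have hpow : ∀ n : ℕ, ∃ P : ι → k, e i ^ (n+2) = ∑ j, P j • e j ∧ ∀ j, P j ≠ 0 → w i < w j := by
    intro n
    induction n with
    | zero =>
      exact ⟨fun j => M i i j, by rw [zero_add, pow_two, he], fun j hj => (hw i i j hj).1⟩
    | succ n ih =>
      obtain ⟨P, hP, _⟩ := ih
      refine ⟨fun j => ∑ a, P a * M a i j, ?_, fun j hj => ?_⟩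
      · rw [show n + 1 + 2 = (n + 2) + 1 by ring, pow_succ, hP, Finset.sum_mul]
        simp only [smul_mul_assoc, he, Finset.smul_sum, Finset.sum_smul, smul_smul]
        exact Finset.sum_comm
      · obtain ⟨a, _, ha⟩ := Finset.exists_ne_zero_of_sum_ne_zero hj
        exact (hw a i j (right_ne_zero_of_mul ha)).2
  choose P hP hPw using hpow
  obtain ⟨q, rfl⟩ : ∃ q, p = q + 2 := ⟨p - 2, by have := hp.two_le; omega⟩
  refine ⟨fun j => (if j = i then y j else 0) + ∑ n ∈ Finset.range q,
    (((n+2).factorial : k)⁻¹ * P n j) • y i ^ (n+2), ?_, fun j => ?_, fun j => ?_⟩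
  · unfold texp UU
    rw [Finset.sum_range_succ', Finset.sum_range_succ']
    simp only [TensorProduct.tmul_add, Finset.sum_add_distrib]
    have h1 : ∑ j, e j ⊗ₜ[k] (if j = i then y j else 0) = e i ⊗ₜ y i := by
      rw [Finset.sum_eq_single i] <;> simp +contextual
    have h2 : ∀ n, (e i ⊗ₜ[k] y i) ^ (n+2) = ∑ j, e j ⊗ₜ[k] (P n j • y i ^ (n+2)) := by
      intro n
      rw [Algebra.TensorProduct.tmul_pow, hP, TensorProduct.sum_tmul]
      simp only [TensorProduct.smul_tmul]
    rw [h1]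
    simp only [add_assoc, show (1:ℕ)+1 = 2 from rfl, h2, TensorProduct.tmul_sum]
    rw [Finset.sum_comm]
    simp only [mul_smul, TensorProduct.tmul_smul, Finset.smul_sum, zero_add, pow_zero, pow_one,
      Nat.factorial_zero, Nat.factorial_one, Nat.cast_one, inv_one, one_smul]
    rw [Finset.sum_comm]
    abel
  · simp only [map_add, map_sum, map_smul, map_pow, hε]
    split_ifs <;> simp [hε]
  · rw [add_sub_cancel_left]
    refine sum_mem fun n _ => ?_
    by_cases h : P n j = 0
    · simp [h]
    · exact Subalgebra.smul_mem _ (pow_mem (Algebra.subset_adjoin (Set.mem_image_of_mem y (hPw n j h))) _) _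

theorem exists_UU [DecidableEq ι] (e : ι → A) (M : ι → ι → ι → k)
    (he : ∀ a b, e a * e b = ∑ j, M a b j • e j)
    (w : ι → ℕ) (hw : ∀ a b j, M a b j ≠ 0 → w a < w j ∧ w b < w j)
    (p : ℕ) (hp : p.Prime) [CharP k p] (hep : ∀ i, e i ^ p = 0)
    (Δ : H →ₐ[k] H ⊗[k] H) (ε : H →ₐ[k] k) (y : ι → H)
    (hΔ : ∀ i, Δ (y i) = y i ⊗ₜ 1 + 1 ⊗ₜ y i) (hε : ∀ i, ε (y i) = 0) (s : Finset ι) :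
    ∃ c : ι → H, RelGrp Δ (UU k e c) ∧ (∀ j, ε (c j) = 0) ∧
      ∀ j, c j - (if j ∈ s then y j else 0) ∈ Algebra.adjoin k (y '' {l | w l < w j}) := by
  induction s using Finset.induction_on with
  | empty =>
    exact ⟨0, by simp [RelGrp, UU], by simp, by simp⟩
  | insert i s his ih =>
    obtain ⟨c, hc1, hc2, hc3⟩ := ih
    obtain ⟨d, hd1, hd2, hd3⟩ := texp_UU e M he w hw p hp ε y hε i
    have hd0 := RelGrp_texp p hp Δ (e i) (hep i) (y i) (hΔ i)
    rw [hd1] at hd0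
    refine ⟨_, UU_mul e M he d c ▸ RelGrp_mul Δ _ _ hd0 hc1, fun j => ?_, fun j => ?_⟩
    · simp [hd2, hc2]
    · have hmono : ∀ (x : ι → H) (P : ι → Prop) [DecidablePred P],
          (∀ j, x j - (if P j then y j else 0) ∈ Algebra.adjoin k (y '' {l | w l < w j})) →
          ∀ a, w a < w j → x a ∈ Algebra.adjoin k (y '' {l | w l < w j}) := by
        intro x P _ hx a ha
        have h1 : x a - (if P a then y a else 0) ∈ Algebra.adjoin k (y '' {l | w l < w j}) :=
          Algebra.adjoin_mono (Set.image_mono fun l (hl : w l < w a) => hl.trans ha) (hx a)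
        have h2 : (if P a then y a else 0) ∈ Algebra.adjoin k (y '' {l | w l < w j}) := by
          split_ifs
          · exact Algebra.subset_adjoin ⟨a, ha, rfl⟩
          · exact zero_mem _
        simpa using add_mem h1 h2
      have h3 : ∑ a, ∑ b, M a b j • (d a * c b) ∈ Algebra.adjoin k (y '' {l | w l < w j}) := by
        refine sum_mem fun a _ => sum_mem fun b _ => ?_
        by_cases h : M a b j = 0
        · simp [h]
        · exact Subalgebra.smul_mem _ (mul_mem (hmono d (· = i) hd3 a (hw a b j h).1)
            (hmono c (· ∈ s) hc3 b (hw a b j h).2)) _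
      have h4 := add_mem (add_mem (hd3 j) (hc3 j)) h3
      convert h4 using 1
      by_cases hji : j = i
      · subst hji
        simp [his]; abel
      · simp [hji]; abel

theorem exists_coeffs [DecidableEq ι] (e : ι → A) (M : ι → ι → ι → k)
    (he : ∀ a b, e a * e b = ∑ j, M a b j • e j)
    (hf : ∀ j, ∃ f : A →ₗ[k] k, f 1 = 0 ∧ ∀ i, f (e i) = if i = j then 1 else 0)
    (w : ι → ℕ) (hw : ∀ a b j, M a b j ≠ 0 → w a < w j ∧ w b < w j)
    (p : ℕ) (hp : p.Prime) [CharP k p] (hep : ∀ i, e i ^ p = 0)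
    (Δ : H →ₐ[k] H ⊗[k] H) (ε : H →ₐ[k] k) (y : ι → H)
    (hΔ : ∀ i, Δ (y i) = y i ⊗ₜ 1 + 1 ⊗ₜ y i) (hε : ∀ i, ε (y i) = 0) :
    ∃ c : ι → H, (∀ j, Δ (c j) = c j ⊗ₜ 1 + 1 ⊗ₜ c j + ∑ a, ∑ b, M a b j • (c a ⊗ₜ[k] c b)) ∧
      (∀ j, ε (c j) = 0) ∧
      ∀ j, c j - y j ∈ Algebra.adjoin k (y '' {l | w l < w j}) := by
  obtain ⟨c, h1, h2, h3⟩ := exists_UU e M he w hw p hp hep Δ ε y hΔ hε Finset.univ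
  refine ⟨c, fun j => ?_, h2, by simpa using h3⟩
  unfold RelGrp at h1
  rw [UU_map, UU_map, UU_map, UU_mul e M he] at h1
  simpa using UU_inj e hf _ _ h1 j

end RelGrp

theorem transposeComul_coord {k m ι : Type*} [Field k] [AddCommGroup m] [Module k m]
    [FiniteDimensional k m] [Fintype ι] [DecidableEq ι]
    (μ : m →ₗ[k] m →ₗ[k] m) (b : Module.Basis ι k m)
    (f : Module.Dual k m) : transposeComul k m μ f =
      ∑ i, ∑ j, f (μ (b i) (b j)) • (b.coord i ⊗ₜ[k] b.coord j) := by
  apply (TensorProduct.dualDistribEquiv k m m).injective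
  apply (b.tensorProduct b).ext
  rintro ⟨i, j⟩
  simp only [transposeComul, LinearMap.comp_apply, LinearEquiv.coe_coe,
    LinearEquiv.apply_symm_apply]
  have : ∀ z, TensorProduct.dualDistribEquiv k m m z = TensorProduct.dualDistrib k m m z := by
    intro z; rfl
  simp [this, Finsupp.single_apply]

theorem exists_coord_ext {k A : Type*} [Field k] [CommRing A] [Algebra k A]
    (m : Submodule k A) (h1 : (1 : A) ∉ m) (g : m →ₗ[k] k) :
    ∃ f : A →ₗ[k] k, f 1 = 0 ∧ ∀ x : m, f x = g x := by
  obtain ⟨g', hg'⟩ := LinearMap.exists_extend g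
  obtain ⟨h, hh1, hh⟩ := Submodule.exists_le_ker_of_notMem h1
  refine ⟨g' - (g' 1 * (h 1)⁻¹) • h, by simp [hh1], fun x => ?_⟩
  have : h x = 0 := hh x.2
  simp [this, ← hg']

/-- Let `k` be an algebraically closed field of characteristic `p > 0` and `A` a
finite-dimensional commutative local `k`-algebra with residue field `k` and maximal ideal
`𝔪 ≠ 0` satisfying `a^p = 0` for all `a ∈ 𝔪`.  Then the bialgebra `T(𝔪^*)` (with
`Δ(x) = x ⊗ 1 + 1 ⊗ x + Δ₀(x)`, `ε(x) = 0` for `x ∈ 𝔪^*`, `Δ₀` the transpose of the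
multiplication of `𝔪`) is isomorphic, as a bialgebra over `k`, to the free associative
algebra on `n = dim_k 𝔪` generators with all generators primitive. -/
theorem tensor_algebra_of_dual_iso_free_primitive
    (k A : Type*) [Field k] [IsAlgClosed k] (p : ℕ) (hp : p.Prime) [CharP k p]
    [CommRing A] [Algebra k A] [IsLocalRing A] [FiniteDimensional k A]
    (hres : ∀ a : A, ∃ c : k, a - algebraMap k A c ∈ IsLocalRing.maximalIdeal A)
    (hm : IsLocalRing.maximalIdeal A ≠ ⊥)
    (hpow : ∀ a ∈ IsLocalRing.maximalIdeal A, a ^ p = 0)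
    -- the bialgebra structure on `T(𝔪^*)`
    (Δ : TensorAlgebra k (Module.Dual k ↥((IsLocalRing.maximalIdeal A).restrictScalars k)) →ₐ[k]
      TensorAlgebra k (Module.Dual k ↥((IsLocalRing.maximalIdeal A).restrictScalars k)) ⊗[k]
      TensorAlgebra k (Module.Dual k ↥((IsLocalRing.maximalIdeal A).restrictScalars k)))
    (ε : TensorAlgebra k (Module.Dual k ↥((IsLocalRing.maximalIdeal A).restrictScalars k))
      →ₐ[k] k)
    (hΔ : ∀ x : Module.Dual k ↥((IsLocalRing.maximalIdeal A).restrictScalars k),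
      Δ (TensorAlgebra.ι k x) =
        (TensorAlgebra.ι k x) ⊗ₜ[k] 1 + 1 ⊗ₜ[k] (TensorAlgebra.ι k x) +
          TensorProduct.map (TensorAlgebra.ι k) (TensorAlgebra.ι k)
            (transposeComul k _ (idealMulBilin k A (IsLocalRing.maximalIdeal A)) x))
    (hε : ∀ x : Module.Dual k ↥((IsLocalRing.maximalIdeal A).restrictScalars k),
      ε (TensorAlgebra.ι k x) = 0)
    -- the bialgebra structure on the free algebra with primitive generators
    (Δ' : FreeAlgebra k (Fin (Module.finrank k
        ↥((IsLocalRing.maximalIdeal A).restrictScalars k))) →ₐ[k]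
      FreeAlgebra k (Fin (Module.finrank k
        ↥((IsLocalRing.maximalIdeal A).restrictScalars k))) ⊗[k]
      FreeAlgebra k (Fin (Module.finrank k
        ↥((IsLocalRing.maximalIdeal A).restrictScalars k))))
    (ε' : FreeAlgebra k (Fin (Module.finrank k
        ↥((IsLocalRing.maximalIdeal A).restrictScalars k))) →ₐ[k] k)
    (hΔ' : ∀ i, Δ' (FreeAlgebra.ι k i) =
      (FreeAlgebra.ι k i) ⊗ₜ[k] 1 + 1 ⊗ₜ[k] (FreeAlgebra.ι k i))
    (hε' : ∀ i, ε' (FreeAlgebra.ι k i) = 0) :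
    -- there is an algebra isomorphism intertwining the two bialgebra structures
    ∃ e : TensorAlgebra k (Module.Dual k ↥((IsLocalRing.maximalIdeal A).restrictScalars k))
        ≃ₐ[k] FreeAlgebra k (Fin (Module.finrank k
          ↥((IsLocalRing.maximalIdeal A).restrictScalars k))),
      (Algebra.TensorProduct.map e.toAlgHom e.toAlgHom).comp Δ = Δ'.comp e.toAlgHom ∧
      ε'.comp e.toAlgHom = ε := by
  classical
  have hprop : (1 : A) ∉ (IsLocalRing.maximalIdeal A).restrictScalars k := fun h =>
    (Ideal.ne_top_iff_one _).1 (IsLocalRing.maximalIdeal.isMaximal A).ne_top h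
  have hart : IsArtinianRing A := IsArtinianRing.of_finite k A
  obtain ⟨N, hN⟩ : IsNilpotent (IsLocalRing.maximalIdeal A) := by
    rw [← IsLocalRing.jacobson_eq_maximalIdeal ⊥ bot_ne_top]
    exact IsArtinianRing.isNilpotent_jacobson_bot
  obtain ⟨B, w, hBw⟩ := aux_basis_weight (idealMulBilin k A (IsLocalRing.maximalIdeal A))
    (fun t => ((IsLocalRing.maximalIdeal A ^ (t + 1)).restrictScalars k).comap
      ((IsLocalRing.maximalIdeal A).restrictScalars k).subtype)
    (fun s t hst x hx => Ideal.pow_le_pow_right (Nat.succ_le_succ hst) hx)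
    (by
      rw [eq_top_iff]
      intro x _
      show x.1 ∈ IsLocalRing.maximalIdeal A ^ (0 + 1)
      rw [zero_add, pow_one]
      exact x.2) N
    (by
      rw [eq_bot_iff]
      intro x hx
      have hx' : x.1 ∈ IsLocalRing.maximalIdeal A ^ (N + 1) := hx
      rw [pow_succ, hN, zero_mul] at hx'
      rw [Submodule.mem_bot]
      exact Subtype.ext hx')
    (by
      intro t x hx y
      show x.1 * y.1 ∈ IsLocalRing.maximalIdeal A ^ (t + 1 + 1)
      rw [pow_succ]
      exact Ideal.mul_mem_mul hx y.2)
  set μ := idealMulBilin k A (IsLocalRing.maximalIdeal A) with hμ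
  have hμv : ∀ x y, (μ x y : A) = x.1 * y.1 := fun x y => rfl
  have hμc : ∀ x y, μ x y = μ y x := fun x y => Subtype.ext (mul_comm x.1 y.1)
  obtain ⟨c, hc1, hc2, hc3⟩ := exists_coeffs (k := k) (fun i => (B i : A))
    (fun a b j => B.coord j (μ (B a) (B b)))
    (by
      intro a b
      have := congrArg (Submodule.subtype _) (B.sum_repr (μ (B a) (B b)))
      simp only [map_sum, map_smul] at this
      exact this.symm)
    (by
      intro j
      obtain ⟨f, hf1, hf⟩ := exists_coord_ext _ hprop (B.coord j)
      refine ⟨f, hf1, fun i => ?_⟩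
      rw [hf]
      simp [Finsupp.single_apply])
    w
    (fun a b j h => ⟨hBw a (B b) j h, hBw b (B a) j (by rwa [hμc])⟩)
    p hp (fun i => hpow _ (B i).2) Δ' ε' (fun i => FreeAlgebra.ι k i) hΔ' hε'
  have hbij := aux_triang w (fun j => c j - FreeAlgebra.ι k j) hc3
  let e := (TensorAlgebra.equivFreeAlgebra B.dualBasis).trans (AlgEquiv.ofBijective _ hbij)
  have he : ∀ j, e (TensorAlgebra.ι k (B.coord j)) = c j := by
    intro j
    have h0 := TensorAlgebra.equivFreeAlgebra_ι_apply B.dualBasis j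
    rw [Module.Basis.coe_dualBasis] at h0
    simp only [e, AlgEquiv.trans_apply]
    rw [h0]
    simp
  refine ⟨e, ?_, ?_⟩
  · apply TensorAlgebra.hom_ext
    apply B.dualBasis.ext
    intro j
    rw [Module.Basis.coe_dualBasis]
    simp only [LinearMap.comp_apply, AlgHom.toLinearMap_apply, AlgHom.comp_apply, hΔ]
    rw [transposeComul_coord _ B]
    simp [he, hc1]
  · apply TensorAlgebra.hom_ext
    apply B.dualBasis.ext
    intro j
    rw [Module.Basis.coe_dualBasis]
    simp [he, hc2, hε]

end
end
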